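/- The braid group B_3(P²) of the projective plane embeds into SL_96(Z); that is, there exists an injective group homomorphism B_3(P²) → SL_96(Z). -/

import Mathlib

/-- The braid group `B_3(P²)` of the projective plane: generators
`δ_1 = of 0`, `δ_2 = of 1`, `ρ_1 = of 2`, `ρ_2 = of 3`, `ρ_3 = of 4`, with the
defining relations of the presentation of `B_n(P²)` specialized to `n = 3`. -/
def relsB3P2 : Set (FreeGroup (Fin 5)) :=
  let d1 : FreeGroup (Fin 5) := FreeGroup.of 0
  let d2 : FreeGroup (Fin 5) := FreeGroup.of 1
  let r1 : FreeGroup (Fin 5) := FreeGroup.of 2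
  let r2 : FreeGroup (Fin 5) := FreeGroup.of 3
  let r3 : FreeGroup (Fin 5) := FreeGroup.of 4
  { -- δ₁δ₂δ₁ = δ₂δ₁δ₂
    d1 * d2 * d1 * (d2 * d1 * d2)⁻¹,
    -- δ_i ρ_j = ρ_j δ_i for j ≠ i, i+1
    d1 * r3 * (r3 * d1)⁻¹,
    d2 * r1 * (r1 * d2)⁻¹,
    -- ρ_i = δ_i ρ_{i+1} δ_i
    r1 * (d1 * r2 * d1)⁻¹,
    r2 * (d2 * r3 * d2)⁻¹,
    -- ρ_{i+1}⁻¹ ρ_i⁻¹ ρ_{i+1} ρ_i = δ_i²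
    r2⁻¹ * r1⁻¹ * r2 * r1 * (d1 ^ 2)⁻¹,
    r3⁻¹ * r2⁻¹ * r3 * r2 * (d2 ^ 2)⁻¹,
    -- δ₁ δ₂² δ₁ = ρ₁²
    d1 * d2 ^ 2 * d1 * (r1 ^ 2)⁻¹ }

/-- The relations satisfied by the torsion elements `a = ρ₃δ₂δ₁` and `b = ρ₂δ₁` of `B_3(P²)`. -/
structure IsTorsionPair {G : Type*} [Group G] (a b : G) : Prop where
  pow_six : a ^ 6 = b ^ 4
  sq_mul_sq : (a ^ 2 * b) ^ 2 = a ^ 6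
  invert : a * (b⁻¹ * a ^ 2 * b ^ 2) * a = b⁻¹ * a ^ 2 * b ^ 2

theorem IsTorsionPair.of_relations {G : Type*} [Group G] {d1 d2 r1 r2 r3 : G}
    (braid : d1 * d2 * d1 = d2 * d1 * d2) (comm : d1 * r3 = r3 * d1)
    (hr1 : r1 = d1 * r2 * d1) (hr2 : r2 = d2 * r3 * d2)
    (hcomm : r2⁻¹ * r1⁻¹ * r2 * r1 = d1 ^ 2) (hsq : d1 * d2 ^ 2 * d1 = r1 ^ 2) :
    IsTorsionPair (r3 * d2 * d1) (r2 * d1) := by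
  obtain ⟨a, ha⟩ : ∃ a, a = r3 * d2 * d1 := ⟨_, rfl⟩
  obtain ⟨x, hx⟩ : ∃ x, x = a * d1 * a⁻¹ := ⟨_, rfl⟩
  have hb : r2 * d1 = d2 * a := by rw [hr2, ha]; group
  have hr1' : r1 = d1 * (d2 * a) := by rw [hr1, mul_assoc, hb]
  have hr2' : r2 = d2 * a * d1⁻¹ := by rw [← hb]; group
  have m2 : a * d2 = d1 * a := by
    calc a * d2 = r3 * (d2 * d1 * d2) := by rw [ha]; group
      _ = r3 * d1 * d2 * d1 := by rw [← braid]; group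
      _ = d1 * a := by rw [← comm, ha]; group
  have m1 : a * d1 = x * a := by rw [hx]; group
  have m2r (w : G) : a * (d2 * w) = d1 * (a * w) := by rw [← mul_assoc, m2, mul_assoc]
  have m1r (w : G) : a * (d1 * w) = x * (a * w) := by rw [← mul_assoc, m1, mul_assoc]
  have m0 : a * x = d2⁻¹ * a := by
    have hβ : (d2 * a) ^ 2 = d1 * (d2 * a) ^ 2 * d1 := by
      calc (d2 * a) ^ 2 = d1 * (d2 * a) ^ 2 * d1⁻¹ * (r2⁻¹ * r1⁻¹ * r2 * r1) := by
            rw [hr1', hr2']; simp only [pow_two]; group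
        _ = d1 * (d2 * a) ^ 2 * d1 := by rw [hcomm]; group
    simp only [pow_two, mul_assoc, m1, m2r] at hβ
    calc a * x = (d1 * d2 * d1)⁻¹ * (d1 * (d2 * (d1 * (a * (x * a))))) * a⁻¹ := by group
      _ = (d2 * d1 * d2)⁻¹ * (d2 * (d1 * (a * a))) * a⁻¹ := by rw [braid, ← hβ]
      _ = d2⁻¹ * a := by group
  have m0r (w : G) : a * (x * w) = d2⁻¹ * (a * w) := by rw [← mul_assoc, m0, mul_assoc]
  have m2i (w : G) : a * (d2⁻¹ * w) = d1⁻¹ * (a * w) := by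
    rw [eq_inv_mul_iff_mul_eq, ← m2r]; group
  have m1i (w : G) : a * (d1⁻¹ * w) = x⁻¹ * (a * w) := by
    rw [eq_inv_mul_iff_mul_eq, ← m1r]; group
  -- the square of `a` as a word in the conjugates of `d2`
  have asq : d2 * (d1 * x) = x * (a * a) := by
    have h : d2 * d1 = x * (d1 * (a * a)) := by
      calc d2 * d1 = (d1 * d2)⁻¹ * (d1 * d2 ^ 2 * d1) := by group
        _ = a * (d1 * (d2 * a)) := by rw [hsq, hr1', pow_two]; group
        _ = _ := by simp only [m2r, m1r]
    have h' : a * (a * (d2 * (d1 * 1))) = a * (a * (x * (d1 * (a * a)))) := by rw [← h]; group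
    simp only [m2r, m1r, m0r, m2i] at h'
    calc d2 * (d1 * x) = d2 * d1 * (x * (d2⁻¹ * (a * (a * 1)))) * (a * a)⁻¹ * d2 := by group
      _ = a * (a * (d2 * 1)) := by rw [h']; simp only [mul_inv_rev, mul_assoc]; simp
      _ = x * (a * a) := by simp only [m1r, mul_one, m2]
  have asqr (w : G) : d2 * (d1 * (x * w)) = x * (a * (a * w)) := by
    simpa only [mul_assoc] using congrArg (· * w) asq
  rw [hb, ← ha]
  have braid' : d2⁻¹ * (x * d2⁻¹) = x * (d2⁻¹ * x) := by
    have h : a * (a * (d1 * (d2 * (d1 * 1)))) = a * (a * (d2 * (d1 * (d2 * 1)))) := by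
      simpa only [mul_assoc, mul_one, mul_right_inj] using braid
    simp only [m2r, m1r, m0r] at h
    simpa only [← mul_assoc, mul_left_inj] using h
  have braidr (w : G) : d2⁻¹ * (x * (d2⁻¹ * w)) = x * (d2⁻¹ * (x * w)) := by
    simpa only [mul_assoc] using congrArg (· * w) braid'
  have ht : (d2 * a)⁻¹ * a ^ 2 * (d2 * a) ^ 2 = x * (d1 * (x * (a * (a * a)))) := by
    rw [mul_assoc, inv_mul_eq_iff_eq_mul]
    simp only [pow_two, mul_assoc, m2r, m1r, m0r]
    rw [mul_inv_cancel_left]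
  refine ⟨?_, ?_, ?_⟩
  · simp only [pow_succ, pow_zero, one_mul, mul_assoc, m2r, m1r, m0r, asqr, m2i, m1i]
    rw [mul_inv_cancel_left]
  · simp only [pow_succ, pow_zero, one_mul, mul_assoc, m2r, m1r, m0r, m2i, m1i]
    rw [mul_inv_cancel_left]
  · rw [ht]
    simp only [mul_assoc, m1r, m0r]
    rw [braidr, mul_right_inj, inv_mul_eq_iff_eq_mul, asqr]

/-- The normal forms of the elements of the subgroup generated by `x` and `y`, where
`x ^ 3 = y ^ 4 = (x * y) ^ 2 = 1`. -/
inductive IsOctahedralForm {G : Type*} [Group G] (x y : G) : G → Prop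
  | pow (j : ℕ) : IsOctahedralForm x y (y ^ j)
  | pow_mul_pow (i j : ℕ) : IsOctahedralForm x y (y ^ i * x * y ^ j)
  | flip_pow (j : ℕ) : IsOctahedralForm x y (x * y ^ 3 * x * y ^ j)

section Octahedral

variable {G : Type*} [Group G] {x y g : G}

theorem octahedral_mul_mul (hxy : (x * y) ^ 2 = 1) (hy : y ^ 4 = 1) : x * y * x = y ^ 3 := by
  have h : x * y * x * y = 1 := by rw [← hxy, pow_two]; simp only [mul_assoc]
  rw [eq_inv_of_mul_eq_one_left h, eq_comm]
  exact eq_inv_of_mul_eq_one_left (by rw [← pow_succ, hy])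

theorem octahedral_mul_self (hx : x ^ 3 = 1) (hxy : (x * y) ^ 2 = 1) : x * x = y * x * y := by
  have h : x * (y * x * y) = 1 := by rw [← hxy, pow_two]; simp only [mul_assoc]
  rw [eq_inv_of_mul_eq_one_right h]
  exact eq_inv_of_mul_eq_one_left (by rw [← hx, pow_succ, pow_two])

theorem IsOctahedralForm.mul_left_y (hx : x ^ 3 = 1) (hy : y ^ 4 = 1) (hxy : (x * y) ^ 2 = 1)
    (h : IsOctahedralForm x y g) : IsOctahedralForm x y (y * g) := by
  have h1 := octahedral_mul_mul hxy hy
  have h2 := octahedral_mul_self hx hxy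
  cases h with
  | pow j => simpa only [← pow_succ'] using IsOctahedralForm.pow (j + 1)
  | pow_mul_pow i j =>
    simpa only [pow_succ', mul_assoc] using IsOctahedralForm.pow_mul_pow (x := x) (y := y) (i + 1) j
  | flip_pow j =>
    have key : y * (x * y ^ 3 * x) * y = x * y ^ 3 * x := by
      calc y * (x * y ^ 3 * x) * y = (y * x * y) * y * (y * x * y) := by
            simp only [pow_succ, pow_zero, one_mul, mul_assoc]
        _ = x * (x * y * x) * x := by rw [← h2]; simp only [mul_assoc]
        _ = _ := by rw [h1]
    have : y * (x * y ^ 3 * x * y ^ j) = x * y ^ 3 * x * y ^ (j + 3) := by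
      calc _ = y * (x * y ^ 3 * x) * (y * y ^ 3) * y ^ j := by
            rw [← pow_succ', hy]; simp only [mul_assoc, mul_one]
        _ = y * (x * y ^ 3 * x) * y * y ^ (j + 3) := by
            rw [add_comm j, pow_add]; simp only [mul_assoc]
        _ = _ := by rw [key]
    rw [this]
    exact .flip_pow _

theorem IsOctahedralForm.mul_left_x (hx : x ^ 3 = 1) (hy : y ^ 4 = 1) (hxy : (x * y) ^ 2 = 1)
    (h : IsOctahedralForm x y g) : IsOctahedralForm x y (x * g) := by
  have h1 := octahedral_mul_mul hxy hy
  have h2 := octahedral_mul_self hx hxy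
  cases h with
  | pow j => simpa using IsOctahedralForm.pow_mul_pow (x := x) (y := y) 0 j
  | pow_mul_pow i j =>
    have hi : y ^ i = y ^ (i % 4) := pow_eq_pow_mod i hy
    have hlt : i % 4 < 4 := Nat.mod_lt _ (by norm_num)
    rw [hi]
    generalize i % 4 = k at hlt
    interval_cases k
    · have : x * (y ^ 0 * x * y ^ j) = y ^ 1 * x * y ^ (j + 1) := by
        rw [pow_zero, one_mul, ← mul_assoc, h2, pow_succ' y j]; simp only [pow_one, mul_assoc]
      rw [this]; exact .pow_mul_pow _ _
    · have : x * (y ^ 1 * x * y ^ j) = y ^ (3 + j) := by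
        rw [pow_one, pow_add, ← h1]; simp only [mul_assoc]
      rw [this]; exact .pow _
    · have key : x * y ^ 2 * x = y ^ 3 * x * y ^ 3 := by
        calc x * y ^ 2 * x = x * y * x * (x * x) * (y * x) := by
              have : x * x * x = 1 := by rw [← hx, pow_succ, pow_two]
              rw [show x * y * x * (x * x) * (y * x) = x * y * (x * x * x) * (y * x) by
                simp only [mul_assoc], this, pow_two]
              simp only [mul_assoc, one_mul]
          _ = y ^ 3 * (x * (x * y * x)) := by rw [← h1]; simp only [mul_assoc]
          _ = _ := by rw [h1]; simp only [mul_assoc]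
      have : x * (y ^ 2 * x * y ^ j) = y ^ 3 * x * y ^ (3 + j) := by
        rw [pow_add, ← mul_assoc _ (y ^ 3), ← key]; simp only [mul_assoc]
      rw [this]; exact .pow_mul_pow _ _
    · simpa only [mul_assoc] using IsOctahedralForm.flip_pow (x := x) (y := y) j
  | flip_pow j =>
    have : x * (x * y ^ 3 * x * y ^ j) = y ^ 2 * x * y ^ (j + 1) := by
      calc _ = (x * x) * y ^ 3 * x * y ^ j := by simp only [mul_assoc]
        _ = y * x * y ^ 4 * x * y ^ j := by rw [h2, pow_succ' y 3]; simp only [mul_assoc]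
        _ = y * (x * x) * y ^ j := by rw [hy]; simp only [mul_assoc, one_mul]
        _ = _ := by rw [h2, pow_two, pow_succ']; simp only [mul_assoc]
    rw [this]; exact .pow_mul_pow _ _

end Octahedral

open Matrix

/-- The universal Coxeter reflection in the `i`-th coordinate of `ℤ⁴`. -/
def coxeterReflection (i : Fin 4) : Matrix (Fin 4) (Fin 4) ℤ :=
  of fun j k => if j = i then (if k = i then -1 else 2) else if j = k then 1 else 0

theorem coxeterReflection_mulVec_of_ne {i j : Fin 4} (h : j ≠ i) (u : Fin 4 → ℤ) :
    (coxeterReflection i *ᵥ u) j = u j := by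
  simp [coxeterReflection, mulVec, dotProduct, h]

theorem lt_coxeterReflection_mulVec {i j k : Fin 4} {u : Fin 4 → ℤ} (hpos : ∀ l, 0 < u l)
    (hki : k ≠ i) (hle : u i ≤ u k) (hji : j ≠ i) : u j < (coxeterReflection i *ᵥ u) i := by
  have h0 := hpos 0
  have h1 := hpos 1
  have h2 := hpos 2
  have h3 := hpos 3
  fin_cases i <;> simp [coxeterReflection, mulVec, dotProduct, Fin.sum_univ_four] <;>
    fin_cases k <;> simp at hki hle <;> fin_cases j <;> simp at hji ⊢ <;> omega

/-- A nonempty reduced word moves the all-ones vector: its first letter gives the strictly largest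
coordinate. -/
theorem coxeterReflection_prod_mulVec_one {w : List (Fin 4)} (hw : w.IsChain (· ≠ ·)) :
    (∀ l, 0 < ((w.map coxeterReflection).prod *ᵥ 1) l) ∧
      ∀ i ∈ w.head?, ∀ j ≠ i, ((w.map coxeterReflection).prod *ᵥ 1) j <
        ((w.map coxeterReflection).prod *ᵥ 1) i := by
  induction w with
  | nil => simp
  | cons i w ih =>
    obtain ⟨hpos, hmax⟩ := ih hw.tail
    set u := (w.map coxeterReflection).prod *ᵥ (1 : Fin 4 → ℤ) with hu
    have hcons : ((i :: w).map coxeterReflection).prod *ᵥ (1 : Fin 4 → ℤ) =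
        coxeterReflection i *ᵥ u := by
      rw [List.map_cons, List.prod_cons, hu, mulVec_mulVec]
    rw [hcons]
    obtain ⟨k, hki, hle⟩ : ∃ k ≠ i, u i ≤ u k := by
      cases w with
      | nil => exact ⟨i + 1, by simp, by simp [hu]⟩
      | cons k w =>
        have hik : i ≠ k := (List.isChain_cons_cons.1 hw).1
        exact ⟨k, hik.symm, (hmax k rfl i hik).le⟩
    have hlt : ∀ j ≠ i, u j < (coxeterReflection i *ᵥ u) i := fun j hj =>
      lt_coxeterReflection_mulVec hpos hki hle hj
    refine ⟨fun l => ?_, ?_⟩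
    · rcases eq_or_ne l i with rfl | hl
      · exact (hpos k).trans (hlt k hki)
      · rw [coxeterReflection_mulVec_of_ne hl]
        exact hpos l
    · rintro _ ⟨⟩ j hj
      rw [coxeterReflection_mulVec_of_ne hj]
      exact hlt j hj

theorem eq_nil_of_coxeterReflection_prod_mulVec_one {w : List (Fin 4)} (hw : w.IsChain (· ≠ ·))
    (h : (w.map coxeterReflection).prod *ᵥ (1 : Fin 4 → ℤ) = 1) : w = [] := by
  cases w with
  | nil => rfl
  | cons i w =>
    have := (coxeterReflection_prod_mulVec_one hw).2 i rfl (i + 1) (by simp)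
    rw [h] at this
    exact absurd this (lt_irrefl _)

theorem List.exists_isChain_prod_eq {ι M : Type*} [Monoid M] {f : ι → M}
    (hf : ∀ i, f i * f i = 1) (w : List ι) :
    ∃ v : List ι, v.IsChain (· ≠ ·) ∧ (v.map f).prod = (w.map f).prod := by
  classical
  induction w with
  | nil => exact ⟨[], by simp, rfl⟩
  | cons i w ih =>
    obtain ⟨v, hv, hvw⟩ := ih
    cases v with
    | nil => exact ⟨[i], by simp, by simp [← hvw]⟩
    | cons j v =>
      rcases eq_or_ne i j with rfl | hij
      · refine ⟨v, hv.tail, ?_⟩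
        rw [List.map_cons, List.prod_cons, ← hvw, List.map_cons, List.prod_cons, ← mul_assoc, hf,
          one_mul]
      · exact ⟨i :: j :: v, List.isChain_cons_cons.2 ⟨hij, hv⟩, by simp [← hvw]⟩

/-- The matrix by which `a` acts on the lattice `ℤ⁴` of the universal Coxeter group. -/
def aMat : Matrix (Fin 4) (Fin 4) ℤ := !![-1, 2, 2, 2; 0, 0, 0, 1; 0, 1, 0, 0; 0, 0, 1, 0]

/-- The matrix by which `b` acts on the lattice `ℤ⁴` of the universal Coxeter group. -/
def bMat : Matrix (Fin 4) (Fin 4) ℤ := !![0, 0, 0, 1; 1, 0, 0, 0; 0, 1, 0, 0; 0, 0, 1, 0]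

theorem bMat_pow_mul_aMat_cube (i : Fin 4) :
    bMat ^ (i : ℕ) * aMat ^ 3 * bMat ^ (3 * (i : ℕ)) = coxeterReflection i := by
  revert i
  decide +kernel

theorem bMat_pow_mulVec (i : Fin 4) : bMat ^ (i : ℕ) *ᵥ 1 = 1 := by
  revert i
  decide +kernel

theorem aMat_sq_mulVec : aMat ^ 2 *ᵥ 1 = 1 := by
  decide +kernel

theorem bMat_pow_ne_one (i : Fin 4) (h : bMat ^ (i : ℕ) = 1) : i = 0 := by
  revert i
  decide +kernel

theorem bMat_pow_mul_aMat_sq_ne_one (i j : Fin 4) :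
    bMat ^ (i : ℕ) * aMat ^ 2 * bMat ^ (j : ℕ) ≠ 1 := by
  revert i j
  decide +kernel

theorem flipMat_mul_bMat_pow_ne_one (j : Fin 4) :
    aMat ^ 2 * bMat ^ 3 * aMat ^ 2 * bMat ^ (j : ℕ) ≠ 1 := by
  revert j
  decide +kernel

namespace IsTorsionPair

variable {G : Type*} [Group G] {a b : G}

theorem commute_pow_six (h : IsTorsionPair a b) : Commute (a ^ 6) b := by
  rw [h.pow_six]
  exact (Commute.refl b).pow_left 4

theorem pow_six_sq (h : IsTorsionPair a b) : (a ^ 6) ^ 2 = 1 := by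
  set t := b⁻¹ * a ^ 2 * b ^ 2 with ht
  have hat : t * a * t⁻¹ = a⁻¹ := by
    rw [mul_inv_eq_iff_eq_mul, eq_inv_mul_iff_mul_eq, ← mul_assoc]
    exact h.invert
  have hcomm : Commute t (a ^ 6) := by
    have hb := h.commute_pow_six.symm
    have ha : Commute a (a ^ 6) := (Commute.refl a).pow_right 6
    exact (hb.inv_left.mul_left (ha.pow_left 2)).mul_left (hb.pow_left 2)
  have hz : a ^ 6 = (a ^ 6)⁻¹ := by
    calc a ^ 6 = t * a ^ 6 * t⁻¹ := by rw [hcomm.eq, mul_inv_cancel_right]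
      _ = (a ^ 6)⁻¹ := by rw [← conj_pow, hat, inv_pow]
  rw [pow_two]
  nth_rewrite 2 [hz]
  exact mul_inv_cancel _

theorem map {H : Type*} [Group H] (h : IsTorsionPair a b) (f : G →* H) :
    IsTorsionPair (f a) (f b) := by
  obtain ⟨h1, h2, h3⟩ := h
  constructor <;> simp only [← map_mul, ← map_pow, ← map_inv] <;> congr 1

/-- The four involutions generating the universal Coxeter group when `a ^ 6 = 1`. -/
def involution (a b : G) (i : Fin 4) : G := b ^ (i : ℕ) * a ^ 3 * b ^ (3 * (i : ℕ))

theorem involution_eq_conj (hb : b ^ 4 = 1) (i : Fin 4) :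
    involution a b i = b ^ (i : ℕ) * a ^ 3 * (b ^ (i : ℕ))⁻¹ := by
  have hi : b ^ (3 * (i : ℕ)) * b ^ (i : ℕ) = 1 := by
    rw [← pow_add, show 3 * (i : ℕ) + i = 4 * i by ring, pow_mul, hb, one_pow]
  rw [involution, eq_inv_of_mul_eq_one_left hi]

theorem involution_mul_self (h : IsTorsionPair a b) (ha : a ^ 6 = 1) (i : Fin 4) :
    involution a b i * involution a b i = 1 := by
  rw [involution_eq_conj (h.pow_six ▸ ha), ← pow_two, conj_pow, ← pow_mul, ha]
  group

theorem mul_involution_b (hb : b ^ 4 = 1) (i : Fin 4) :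
    b * involution a b i = involution a b (i + 1) * b := by
  have hi : b ^ ((i + 1 : Fin 4) : ℕ) = b * b ^ (i : ℕ) := by
    rw [Fin.val_add, ← pow_eq_pow_mod _ hb]
    exact pow_succ' b i
  rw [involution_eq_conj hb, involution_eq_conj hb, hi]
  group

theorem sq_mul_involution (h : IsTorsionPair a b) (ha : a ^ 6 = 1) (i : Fin 4) :
    a ^ 2 * involution a b i = involution a b (![0, 3, 1, 2] i) * a ^ 2 := by
  have hb : b ^ 4 = 1 := h.pow_six ▸ ha
  have hb3 : b ^ 3 = b⁻¹ := eq_inv_of_mul_eq_one_left (by rw [← pow_succ, hb])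
  have ha3 : (a ^ 3)⁻¹ = a ^ 3 := inv_eq_of_mul_eq_one_left (by rw [← pow_add, ha])
  have h0 : a ^ 2 * involution a b 0 = involution a b 0 * a ^ 2 := by
    simp [involution, ← pow_add]
  have h1 : a ^ 2 * involution a b 1 = involution a b 3 * a ^ 2 := by
    have hxy : a ^ 2 * b * (a ^ 2 * b) = 1 := by rw [← pow_two, h.sq_mul_sq, ha]
    have e1 : a ^ 2 * b = b⁻¹ * (a ^ 2)⁻¹ := by
      rw [eq_inv_of_mul_eq_one_left hxy, _root_.mul_inv_rev]
    have e2 : b * a ^ 2 = (a ^ 2)⁻¹ * b⁻¹ := by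
      rw [← _root_.mul_inv_rev, eq_inv_iff_mul_eq_one]
      calc _ = b * (a ^ 2 * b * (a ^ 2 * b)) * b⁻¹ := by group
        _ = 1 := by rw [hxy]; group
    simp only [involution_eq_conj hb]
    calc a ^ 2 * (b ^ 1 * a ^ 3 * (b ^ 1)⁻¹) = a ^ 2 * b * a ^ 3 * b⁻¹ := by group
      _ = b⁻¹ * a ^ 3 * (b * a ^ 2) := by rw [e1, e2]; group
      _ = b ^ 3 * a ^ 3 * (b ^ 3)⁻¹ * a ^ 2 := by rw [hb3]; group
  have h2 : a ^ 2 * involution a b 2 = involution a b 1 * a ^ 2 := by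
    set t := b⁻¹ * a ^ 2 * b ^ 2 with ht
    have hat : t * a = a⁻¹ * t := by
      rw [eq_inv_mul_iff_mul_eq, ← mul_assoc]
      exact h.invert
    have hat3 : t * a ^ 3 = a ^ 3 * t := by
      nth_rewrite 2 [← ha3]
      rw [← inv_pow]
      exact (SemiconjBy.pow_right (show SemiconjBy t a a⁻¹ from hat) 3)
    simp only [involution_eq_conj hb]
    calc a ^ 2 * (b ^ 2 * a ^ 3 * (b ^ 2)⁻¹) = b * (t * a ^ 3) * (b ^ 2)⁻¹ := by rw [ht]; group
      _ = b ^ 1 * a ^ 3 * (b ^ 1)⁻¹ * a ^ 2 := by rw [hat3, ht]; group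
  have h3 : a ^ 2 * involution a b 3 = involution a b 2 * a ^ 2 := by
    calc a ^ 2 * involution a b 3 = a ^ 2 * (involution a b 3 * a ^ 2) * (a ^ 2)⁻¹ := by group
      _ = a ^ 2 * a ^ 2 * (involution a b 1 * a ^ 2) * (a ^ 2)⁻¹ * (a ^ 2)⁻¹ := by
          rw [← h1]; group
      _ = a ^ 6 * involution a b 2 * (a ^ 6)⁻¹ * a ^ 2 := by rw [← h2]; group
      _ = _ := by rw [ha]; group
  fin_cases i
  exacts [h0, h1, h2, h3]

theorem exists_form (h : IsTorsionPair a b) (ha : a ^ 6 = 1)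
    (hgen : Subgroup.closure {a, b} = ⊤) (g : G) :
    ∃ w : List (Fin 4), ∃ t, IsOctahedralForm (a ^ 2) b t ∧
      g = (w.map (involution a b)).prod * t := by
  have hb : b ^ 4 = 1 := h.pow_six ▸ ha
  have hx : (a ^ 2) ^ 3 = 1 := by rw [← pow_mul, ha]
  have hxy : (a ^ 2 * b) ^ 2 = 1 := by rw [h.sq_mul_sq, ha]
  have hword {y : G} {σ : Fin 4 → Fin 4}
      (hy : ∀ i, y * involution a b i = involution a b (σ i) * y) (w : List (Fin 4)) :
      y * (w.map (involution a b)).prod = ((w.map σ).map (involution a b)).prod * y := by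
    induction w with
    | nil => simp
    | cons i w ih =>
      simp only [List.map_cons, List.prod_cons, ← mul_assoc, hy]
      rw [mul_assoc, ih, ← mul_assoc]
  let P : G → Prop := fun g => ∃ w : List (Fin 4), ∃ t, IsOctahedralForm (a ^ 2) b t ∧
      g = (w.map (involution a b)).prod * t
  have hPb {g : G} : P g → P (b * g) := by
    rintro ⟨w, t, ht, rfl⟩
    exact ⟨w.map (· + 1), b * t, ht.mul_left_y hx hb hxy, by
      rw [← mul_assoc, hword (mul_involution_b hb), mul_assoc]⟩
  have hPx {g : G} : P g → P (a ^ 2 * g) := by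
    rintro ⟨w, t, ht, rfl⟩
    exact ⟨w.map ![0, 3, 1, 2], a ^ 2 * t, ht.mul_left_x hx hb hxy, by
      rw [← mul_assoc, hword (h.sq_mul_involution ha), mul_assoc]⟩
  have hPa {g : G} (hg : P g) : P (a * g) := by
    obtain ⟨w, t, ht, e⟩ := hPx (hPx hg)
    refine ⟨0 :: w, t, ht, ?_⟩
    rw [List.map_cons, List.prod_cons, mul_assoc, ← e]
    simp only [involution, Fin.val_zero, pow_zero, mul_zero, one_mul, mul_one, ← mul_assoc,
      ← pow_add]
    rw [pow_succ a 6, ha, one_mul]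
  have hgmem : g ∈ Subgroup.closure {a, b} := hgen ▸ Subgroup.mem_top g
  have hainv : a⁻¹ = a ^ 5 := (eq_inv_of_mul_eq_one_left (by rw [← pow_succ, ha])).symm
  have hbinv : b⁻¹ = b ^ 3 := (eq_inv_of_mul_eq_one_left (by rw [← pow_succ, hb])).symm
  change P g
  induction hgmem using Subgroup.closure_induction_left with
  | one => exact ⟨[], 1, by simpa using IsOctahedralForm.pow (x := a ^ 2) (y := b) 0, by simp⟩
  | mul_left y hy g _ ih =>
    rcases hy with rfl | rfl
    exacts [hPa ih, hPb ih]
  | inv_mul_cancel y hy g _ ih =>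
    rcases hy with rfl | rfl
    · rw [hainv]
      simp only [pow_succ, pow_zero, one_mul, mul_assoc]
      exact hPa (hPa (hPa (hPa (hPa ih))))
    · rw [hbinv]
      simp only [pow_succ, pow_zero, one_mul, mul_assoc]
      exact hPb (hPb (hPb ih))

theorem injective (h : IsTorsionPair a b) (ha : a ^ 6 = 1)
    (hgen : Subgroup.closure {a, b} = ⊤) (f : G →* Matrix (Fin 4) (Fin 4) ℤ)
    (hfa : f a = aMat) (hfb : f b = bMat) : Function.Injective f := by
  have hb : b ^ 4 = 1 := h.pow_six ▸ ha
  rw [injective_iff_map_eq_one]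
  intro g hg
  obtain ⟨w, t, ht, rfl⟩ := h.exists_form ha hgen g
  obtain ⟨v, hv, hvw⟩ := List.exists_isChain_prod_eq (h.involution_mul_self ha) w
  have hinv : f ∘ involution a b = coxeterReflection := by
    ext1 i
    simp [involution, hfa, hfb, bMat_pow_mul_aMat_cube]
  have hbmod (j : ℕ) : ∃ i : Fin 4, b ^ j = b ^ (i : ℕ) :=
    ⟨⟨j % 4, Nat.mod_lt _ (by norm_num)⟩, pow_eq_pow_mod j hb⟩
  have hfix : f t *ᵥ 1 = 1 := by
    cases ht with
    | pow j =>
      obtain ⟨i, hi⟩ := hbmod j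
      rw [hi, map_pow, hfb, bMat_pow_mulVec]
    | pow_mul_pow i j =>
      obtain ⟨i', hi⟩ := hbmod i
      obtain ⟨j', hj⟩ := hbmod j
      simp only [hi, hj, map_mul, map_pow, hfa, hfb, ← mulVec_mulVec, bMat_pow_mulVec,
        aMat_sq_mulVec]
    | flip_pow j =>
      obtain ⟨j', hj⟩ := hbmod j
      have := bMat_pow_mulVec 3
      simp only [hj, map_mul, map_pow, hfa, hfb, ← mulVec_mulVec, bMat_pow_mulVec, aMat_sq_mulVec]
      erw [this, aMat_sq_mulVec]
  rw [← hvw] at hg ⊢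
  have hnil : v = [] := by
    apply eq_nil_of_coxeterReflection_prod_mulVec_one hv
    have := congrArg (· *ᵥ (1 : Fin 4 → ℤ)) hg
    simpa only [map_mul, map_list_prod, List.map_map, hinv, ← mulVec_mulVec, hfix, one_mulVec]
      using this
  subst hnil
  simp only [List.map_nil, List.prod_nil, one_mul] at hg ⊢
  cases ht with
  | pow j =>
    obtain ⟨i, hi⟩ := hbmod j
    rw [hi, map_pow, hfb] at hg
    rw [hi, bMat_pow_ne_one i hg, Fin.val_zero, pow_zero]
  | pow_mul_pow i j =>
    obtain ⟨i', hi⟩ := hbmod i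
    obtain ⟨j', hj⟩ := hbmod j
    simp only [hi, hj, map_mul, map_pow, hfa, hfb] at hg
    exact absurd hg (bMat_pow_mul_aMat_sq_ne_one i' j')
  | flip_pow j =>
    obtain ⟨j', hj⟩ := hbmod j
    simp only [hj, map_mul, map_pow, hfa, hfb] at hg
    exact absurd hg (flipMat_mul_bMat_pow_ne_one j')

end IsTorsionPair

/-- The defining relations of `B_3(P²)`, for elements `d1`, `d2`, `r1`, `r2`, `r3` of a monoid. -/
structure SatisfiesRelsB3P2 {M : Type*} [Monoid M] (d1 d2 r1 r2 r3 : M) : Prop where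
  braid : d1 * d2 * d1 = d2 * d1 * d2
  comm_d1_r3 : d1 * r3 = r3 * d1
  comm_d2_r1 : d2 * r1 = r1 * d2
  r1_eq : r1 = d1 * r2 * d1
  r2_eq : r2 = d2 * r3 * d2
  commutator_r1 : r2 * r1 = r1 * r2 * d1 ^ 2
  commutator_r2 : r3 * r2 = r2 * r3 * d2 ^ 2
  sq : d1 * d2 ^ 2 * d1 = r1 ^ 2

namespace SatisfiesRelsB3P2

theorem isTorsionPair {G : Type*} [Group G] {d1 d2 r1 r2 r3 : G}
    (h : SatisfiesRelsB3P2 d1 d2 r1 r2 r3) : IsTorsionPair (r3 * d2 * d1) (r2 * d1) := by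
  refine .of_relations h.braid h.comm_d1_r3 h.r1_eq h.r2_eq ?_ h.sq
  rw [mul_assoc, h.commutator_r1]
  group

theorem subset_closure {G : Type*} [Group G] {d1 d2 r1 r2 r3 : G}
    (h : SatisfiesRelsB3P2 d1 d2 r1 r2 r3) :
    ({d1, d2, r1, r2, r3} : Set G) ⊆ Subgroup.closure {r3 * d2 * d1, r2 * d1} := by
  set S := Subgroup.closure {r3 * d2 * d1, r2 * d1}
  have ha : r3 * d2 * d1 ∈ S := Subgroup.subset_closure (by simp)
  have hb : r2 * d1 ∈ S := Subgroup.subset_closure (by simp)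
  have hd2 : d2 ∈ S := by
    have : d2 = r2 * d1 * (r3 * d2 * d1)⁻¹ := by rw [h.r2_eq]; group
    rw [this]
    exact S.mul_mem hb (S.inv_mem ha)
  have hd1 : d1 ∈ S := by
    have : d1 = r3 * d2 * d1 * d2 * (r3 * d2 * d1)⁻¹ := by
      calc d1 = d1 * r3 * d2 * d1 * (r3 * d2 * d1)⁻¹ := by group
        _ = r3 * (d1 * d2 * d1) * (r3 * d2 * d1)⁻¹ := by rw [h.comm_d1_r3]; group
        _ = _ := by rw [h.braid]; group
    rw [this]
    exact S.mul_mem (S.mul_mem ha hd2) (S.inv_mem ha)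
  have hr2 : r2 ∈ S := (S.mul_mem_cancel_right hd1).1 hb
  have hr3 : r3 ∈ S := (S.mul_mem_cancel_right hd2).1 ((S.mul_mem_cancel_right hd1).1 ha)
  have hr1 : r1 ∈ S := h.r1_eq ▸ S.mul_mem (S.mul_mem hd1 hr2) hd1
  rintro _ (rfl | rfl | rfl | rfl | rfl) <;> assumption

theorem of_presentedGroup :
    SatisfiesRelsB3P2 (PresentedGroup.of 0 : PresentedGroup relsB3P2) (PresentedGroup.of 1)
      (PresentedGroup.of 2) (PresentedGroup.of 3) (PresentedGroup.of 4) := by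
  have key {x y : FreeGroup (Fin 5)} (hxy : x * y⁻¹ ∈ relsB3P2) :
      PresentedGroup.mk relsB3P2 x = PresentedGroup.mk relsB3P2 y :=
    PresentedGroup.mk_eq_mk_of_mul_inv_mem hxy
  constructor
  · exact key (Or.inl rfl)
  · exact key (Or.inr (Or.inl rfl))
  · exact key (Or.inr (Or.inr (Or.inl rfl)))
  · exact key (Or.inr (Or.inr (Or.inr (Or.inl rfl))))
  · exact key (Or.inr (Or.inr (Or.inr (Or.inr (Or.inl rfl)))))
  · have := key (Or.inr (Or.inr (Or.inr (Or.inr (Or.inr (Or.inl rfl))))))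
    simp only [map_mul, map_inv, mul_assoc, inv_mul_eq_iff_eq_mul] at this
    rw [mul_assoc]
    exact this
  · have := key (Or.inr (Or.inr (Or.inr (Or.inr (Or.inr (Or.inr (Or.inl rfl)))))))
    simp only [map_mul, map_inv, mul_assoc, inv_mul_eq_iff_eq_mul] at this
    rw [mul_assoc]
    exact this
  · exact key (Or.inr (Or.inr (Or.inr (Or.inr (Or.inr (Or.inr (Or.inr rfl)))))))

variable {M : Type*} [Monoid M] {d1 d2 r1 r2 r3 : Mˣ}

/-- The representation of `B_3(P²)` given by units satisfying the defining relations. -/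
def lift (h : SatisfiesRelsB3P2 (d1 : M) (d2 : M) (r1 : M) (r2 : M) (r3 : M)) :
    PresentedGroup relsB3P2 →* Mˣ :=
  PresentedGroup.toGroup (f := ![d1, d2, r1, r2, r3]) <| by
    obtain ⟨h1, h2, h3, h4, h5, h6, h7, h8⟩ := h
    norm_cast at h1 h2 h3 h4 h5 h6 h7 h8
    rintro _ (rfl | rfl | rfl | rfl | rfl | rfl | rfl | rfl) <;>
      simp only [map_mul, map_inv, map_pow, mul_inv_eq_one, FreeGroup.lift_apply_of]
    exacts [h1, h2, h3, h4, h5, by simp [mul_assoc, h6],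
      by simp [mul_assoc, h7], h8]

theorem lift_of (h : SatisfiesRelsB3P2 (d1 : M) (d2 : M) (r1 : M) (r2 : M) (r3 : M)) (i : Fin 5) :
    h.lift (.of i) = ![d1, d2, r1, r2, r3] i :=
  PresentedGroup.toGroup.of _

end SatisfiesRelsB3P2

theorem closure_eq_top_B3P2 :
    Subgroup.closure {(.of 4 * .of 1 * .of 0 : PresentedGroup relsB3P2), .of 3 * .of 0} = ⊤ := by
  rw [eq_top_iff, ← PresentedGroup.closure_range_of, Subgroup.closure_le]
  rintro _ ⟨i, rfl⟩
  apply SatisfiesRelsB3P2.of_presentedGroup.subset_closure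
  fin_cases i <;> simp

/-- The kernel of a representation extending `aMat`, `bMat` is contained in `{1, a ^ 6}`. -/
theorem eq_one_or_eq_of_map_eq_one {G : Type*} [Group G] {a b : G} (h : IsTorsionPair a b)
    (hgen : Subgroup.closure {a, b} = ⊤) (f : G →* (Matrix (Fin 4) (Fin 4) ℤ)ˣ)
    (hfa : (f a : Matrix (Fin 4) (Fin 4) ℤ) = aMat) (hfb : (f b : Matrix (Fin 4) (Fin 4) ℤ) = bMat)
    {g : G} (hg : f g = 1) : g = 1 ∨ g = a ^ 6 := by
  have hcenter : a ^ 6 ∈ Subgroup.center G := by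
    rw [← Subgroup.centralizer_univ, ← Subgroup.coe_top, ← hgen, Subgroup.centralizer_closure,
      Subgroup.mem_centralizer_iff]
    rintro _ (rfl | rfl)
    exacts [((Commute.refl _).pow_right 6).eq, h.commute_pow_six.symm.eq]
  set N := Subgroup.zpowers (a ^ 6) with hN
  have hNcenter : N ≤ Subgroup.center G := by rwa [hN, Subgroup.zpowers_le]
  have : N.Normal := ⟨fun n hn g => by
    rwa [Subgroup.mem_center_iff.1 (hNcenter hn) g, mul_inv_cancel_right]⟩
  have hker : N ≤ f.ker := by
    rw [hN, Subgroup.zpowers_le, MonoidHom.mem_ker, Units.ext_iff, map_pow,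
      Units.val_pow_eq_pow_val, hfa]
    decide +kernel
  have hinj := (h.map (QuotientGroup.mk' N)).injective (by
    rw [← map_pow]
    exact (QuotientGroup.eq_one_iff _).2 (Subgroup.mem_zpowers _)) (by
    rw [← Set.image_pair, ← MonoidHom.map_closure, hgen]
    exact Subgroup.map_top_of_surjective _ (QuotientGroup.mk'_surjective N))
    ((Units.coeHom _).comp (QuotientGroup.lift N f hker)) hfa hfb
  have hgN : (g : G ⧸ N) = 1 := by
    apply hinj
    change ((f g : (Matrix (Fin 4) (Fin 4) ℤ)ˣ) : Matrix (Fin 4) (Fin 4) ℤ) = _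
    rw [hg, map_one, Units.val_one]
  rw [QuotientGroup.eq_one_iff, hN, Subgroup.mem_zpowers_iff] at hgN
  obtain ⟨k, rfl⟩ := hgN
  have hz : (a ^ 6) ^ (2 : ℤ) = 1 := by exact_mod_cast h.pow_six_sq
  rcases Int.even_or_odd' k with ⟨m, rfl | rfl⟩
  · left
    rw [_root_.zpow_mul, hz, _root_.one_zpow]
  · right
    rw [_root_.zpow_add, _root_.zpow_mul, hz, _root_.one_zpow, one_mul, zpow_one]

theorem exists_injective_specialLinearGroup {G m n ι κ : Type*} [Group G] [Fintype m]
    [DecidableEq m] [Fintype n] [DecidableEq n] [Fintype ι] [DecidableEq ι] [Nonempty ι]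
    [Fintype κ] [DecidableEq κ] (e : (m ⊕ n) × ι ≃ κ) (hι : Even (Fintype.card ι))
    (f : G →* (Matrix m m ℤ)ˣ) (f' : G →* (Matrix n n ℤ)ˣ)
    (h : ∀ g, f g = 1 → f' g = 1 → g = 1) :
    ∃ F : G →* SpecialLinearGroup κ ℤ, Function.Injective F := by
  let B : G → Matrix (m ⊕ n) (m ⊕ n) ℤ := fun g => fromBlocks (f g) 0 0 (f' g)
  have hB1 : B 1 = 1 := by simp [B]
  have hBmul (x y : G) : B (x * y) = B x * B y := by simp [B, fromBlocks_multiply]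
  let F₀ : G →* Matrix κ κ ℤ :=
    { toFun := fun g => reindexAlgEquiv ℤ ℤ e (blockDiagonal fun _ : ι => B g)
      map_one' := by
        rw [hB1]
        exact (congrArg _ blockDiagonal_one).trans (map_one _)
      map_mul' := fun x y => by
        rw [← map_mul, ← blockDiagonal_mul, hBmul] }
  have hdet (g : G) : (F₀ g).det = 1 := by
    have hunit : IsUnit (B g).det :=
      (isUnit_iff_isUnit_det _).1 (IsUnit.of_mul_eq_one (B g⁻¹) (by
        rw [← hBmul, mul_inv_cancel, hB1]))
    change (reindex e e (blockDiagonal fun _ : ι => B g)).det = 1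
    rw [det_reindex_self, det_blockDiagonal, Finset.prod_const, Finset.card_univ]
    rcases Int.isUnit_iff.1 hunit with h1 | h1 <;> rw [h1]
    exacts [one_pow _, hι.neg_one_pow]
  refine ⟨{ toFun := fun g => ⟨F₀ g, hdet g⟩
            map_one' := Subtype.ext (map_one F₀)
            map_mul' := fun x y => Subtype.ext (map_mul F₀ x y) }, ?_⟩
  rw [injective_iff_map_eq_one]
  intro g hg
  have h1 : F₀ g = F₀ 1 := (congrArg Subtype.val hg).trans (map_one F₀).symm
  have h2 : B g = B 1 :=
    congrFun (blockDiagonal_injective ((reindexAlgEquiv ℤ ℤ e).injective h1))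
      (Classical.arbitrary ι)
  obtain ⟨h3, -, -, h4⟩ := fromBlocks_inj.1 h2
  exact h g (Units.ext (by simpa using h3)) (Units.ext (by simpa using h4))

/-- The action on the universal Coxeter group of rank four, linearized on `ℤ⁴`. -/
theorem exists_rep_coxeter :
    ∃ f : PresentedGroup relsB3P2 →* (Matrix (Fin 4) (Fin 4) ℤ)ˣ,
      (f (.of 4 * .of 1 * .of 0) : Matrix (Fin 4) (Fin 4) ℤ) = aMat ∧
      (f (.of 3 * .of 0) : Matrix (Fin 4) (Fin 4) ℤ) = bMat := by
  let d1 : (Matrix (Fin 4) (Fin 4) ℤ)ˣ :=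
    ⟨!![2, 2, -1, 2; 0, 1, 0, 0; 1, 0, 0, 0; 0, 0, 0, 1],
     !![0, 0, 1, 0; 0, 1, 0, 0; -1, 2, 2, 2; 0, 0, 0, 1], by decide +kernel, by decide +kernel⟩
  let d2 : (Matrix (Fin 4) (Fin 4) ℤ)ˣ :=
    ⟨!![0, 1, 0, 0; -1, 2, 2, 2; 0, 0, 1, 0; 0, 0, 0, 1],
     !![2, -1, 2, 2; 1, 0, 0, 0; 0, 0, 1, 0; 0, 0, 0, 1], by decide +kernel, by decide +kernel⟩
  let r1 : (Matrix (Fin 4) (Fin 4) ℤ)ˣ :=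
    ⟨!![2, -1, 2, 2; 1, 0, 0, 0; 0, 0, 0, 1; 0, 0, 1, 0],
     !![0, 1, 0, 0; -1, 2, 2, 2; 0, 0, 0, 1; 0, 0, 1, 0], by decide +kernel, by decide +kernel⟩
  let r2 : (Matrix (Fin 4) (Fin 4) ℤ)ˣ :=
    ⟨!![0, 0, 0, 1; 0, 0, 1, 0; 0, 1, 0, 0; -1, 2, 2, 2],
     !![2, 2, 2, -1; 0, 0, 1, 0; 0, 1, 0, 0; 1, 0, 0, 0], by decide +kernel, by decide +kernel⟩
  let r3 : (Matrix (Fin 4) (Fin 4) ℤ)ˣ :=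
    ⟨!![2, 2, -1, 2; 0, 0, 0, 1; 1, 0, 0, 0; 0, 1, 0, 0],
     !![0, 0, 1, 0; 0, 0, 0, 1; -1, 2, 2, 2; 0, 1, 0, 0], by decide +kernel, by decide +kernel⟩
  have h : SatisfiesRelsB3P2 d1.val d2.val r1.val r2.val r3.val := by
    constructor <;> decide +kernel
  refine ⟨h.lift, ?_, ?_⟩ <;> simp only [map_mul, h.lift_of, Units.val_mul] <;> decide +kernel

/-- A representation of `B_3(P²)` that is nontrivial on the central involution. -/
theorem exists_rep_spin :
    ∃ f : PresentedGroup relsB3P2 →* (Matrix (Fin 8) (Fin 8) ℤ)ˣ,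
      f ((.of 3 * .of 0) ^ 4) ≠ 1 := by
  let d1Mat : Matrix (Fin 8) (Fin 8) ℤ :=
    !![0, 0, 0, 0, 1, 0, 0, 0;
      0, 0, 0, 0, 1, 0, -1, 0;
      0, 0, 0, 0, 1, -1, 0, 0;
      0, 0, 0, 0, -2, 0, 0, -1;
      -1, 0, 0, 0, 0, 0, 0, 0;
      -1, 0, 1, 0, 0, 0, 0, 0;
      -1, 1, 0, 0, 0, 0, 0, 0;
      2, 0, 0, 1, 0, 0, 0, 0]
  let d2Mat : Matrix (Fin 8) (Fin 8) ℤ :=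
    !![0, 0, 0, 0, -1, 0, -1, -1;
      0, 0, 0, 0, -1, -1, 0, -1;
      0, 0, 0, 0, -1, 0, 0, -1;
      0, 0, 0, 0, 1, 1, 1, 2;
      1, 1, 0, 1, 0, 0, 0, 0;
      0, 1, -1, 0, 0, 0, 0, 0;
      1, 0, -1, 0, 0, 0, 0, 0;
      -1, -1, 1, -1, 0, 0, 0, 0]
  let r1Mat : Matrix (Fin 8) (Fin 8) ℤ :=
    !![1, 0, 0, 0, 0, 0, 0, 0;
      1, 0, -1, 0, 0, 0, 0, 0;
      1, -1, 0, 0, 0, 0, 0, 0;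
      -2, 0, 0, -1, 0, 0, 0, 0;
      0, 0, 0, 0, 0, 1, 1, 1;
      0, 0, 0, 0, 0, 1, 0, 0;
      0, 0, 0, 0, 1, 1, 0, 1;
      0, 0, 0, 0, 0, -2, 0, -1]
  let r2Mat : Matrix (Fin 8) (Fin 8) ℤ :=
    !![0, 1, 1, 1, 0, 0, 0, 0;
      0, 1, 0, 0, 0, 0, 0, 0;
      1, 1, 0, 1, 0, 0, 0, 0;
      0, -2, 0, -1, 0, 0, 0, 0;
      0, 0, 0, 0, -1, 0, 0, 0;
      0, 0, 0, 0, -1, 0, 1, 0;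
      0, 0, 0, 0, -1, 1, 0, 0;
      0, 0, 0, 0, 2, 0, 0, 1]
  let r3Mat : Matrix (Fin 8) (Fin 8) ℤ :=
    !![1, 0, 0, 1, 0, 0, 0, 0;
      0, 1, 0, 1, 0, 0, 0, 0;
      0, 0, -1, 0, 0, 0, 0, 0;
      0, 0, 0, -1, 0, 0, 0, 0;
      0, 0, 0, 0, -1, 0, 0, -1;
      0, 0, 0, 0, 0, -1, 0, -1;
      0, 0, 0, 0, 0, 0, 1, 0;
      0, 0, 0, 0, 0, 0, 0, 1]
  let d1 : (Matrix (Fin 8) (Fin 8) ℤ)ˣ :=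
    ⟨d1Mat, -d1Mat, by decide +kernel, by decide +kernel⟩
  let d2 : (Matrix (Fin 8) (Fin 8) ℤ)ˣ :=
    ⟨d2Mat, -d2Mat, by decide +kernel, by decide +kernel⟩
  let r1 : (Matrix (Fin 8) (Fin 8) ℤ)ˣ :=
    ⟨r1Mat, r1Mat, by decide +kernel, by decide +kernel⟩
  let r2 : (Matrix (Fin 8) (Fin 8) ℤ)ˣ :=
    ⟨r2Mat, r2Mat, by decide +kernel, by decide +kernel⟩
  let r3 : (Matrix (Fin 8) (Fin 8) ℤ)ˣ :=
    ⟨r3Mat, r3Mat, by decide +kernel, by decide +kernel⟩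
  have h : SatisfiesRelsB3P2 d1.val d2.val r1.val r2.val r3.val := by
    constructor <;> decide +kernel
  refine ⟨h.lift, fun hf => ?_⟩
  simp only [map_mul, map_pow, h.lift_of] at hf
  have hpow : ((r2.val * d1.val) ^ 4) 0 0 = 1 := congrArg (fun u => u.val 0 0) hf
  revert hpow
  decide +kernel

/-- Theorem 6.2: the braid group `B_3(P²)` of the projective plane embeds into
`SL_96(ℤ)`. -/
theorem B3P2_embeds_SL96 :
    ∃ f : PresentedGroup relsB3P2 →* Matrix.SpecialLinearGroup (Fin 96) ℤ,
      Function.Injective f := by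
  have h := SatisfiesRelsB3P2.of_presentedGroup.isTorsionPair
  obtain ⟨f, hfa, hfb⟩ := exists_rep_coxeter
  obtain ⟨f', hf'⟩ := exists_rep_spin
  have e : (Fin 4 ⊕ Fin 8) × Fin 8 ≃ Fin 96 := Fintype.equivFinOfCardEq (by simp)
  refine exists_injective_specialLinearGroup e (by decide) f f' fun g hg hg' => ?_
  rcases eq_one_or_eq_of_map_eq_one h closure_eq_top_B3P2 f hfa hfb hg with rfl | rfl
  · rfl
  · rw [h.pow_six] at hg'
    exact absurd hg' hf'
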